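/- arXiv:2603.03139 — 5 statements merged into one kernel-verified Lean document; each statement's English description precedes it below -/
import Mathlib

section
/- Let q, s ≥ 1 be integers, let t = (t_1,…,t_q) ∈ ℕ_+^q, and let n ≥ ‖t‖_∞ + Λ_t + 1 + 7(q+1)(s−1). If G is an n-vertex s-connector, then G → tK_2. -/
open SimpleGraph

variable {V : Type*}

/-- `M` is a set of edges of `G` forming a matching (pairwise disjoint edges). -/
def IsMatchingSet (G : SimpleGraph V) (M : Finset (Sym2 V)) : Prop :=
  (∀ e ∈ M, e ∈ G.edgeSet) ∧
    ∀ e ∈ M, ∀ f ∈ M, e ≠ f → ∀ v : V, v ∈ e → v ∉ f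

/-- The matching number `ν(G)`. -/
noncomputable def matchingNumber (G : SimpleGraph V) : ℕ :=
  sSup {n | ∃ M : Finset (Sym2 V), IsMatchingSet G M ∧ M.card = n}

/-- `ν_G(X,Y)`: the maximum size of a matching of `G` each edge of which has one
endpoint in `X` and one endpoint in `Y`. -/
noncomputable def nuBetween (G : SimpleGraph V) (X Y : Set V) : ℕ :=
  sSup {n | ∃ M : Finset (Sym2 V), IsMatchingSet G M ∧ M.card = n ∧
    ∀ e ∈ M, ∃ x ∈ X, ∃ y ∈ Y, e = s(x, y)}

/-- The set `D` of the Gallai–Edmonds decomposition: the inessential vertices,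
i.e. those missed by some maximum matching. -/
def geD (G : SimpleGraph V) : Set V :=
  {v | ∃ M : Finset (Sym2 V), IsMatchingSet G M ∧ M.card = matchingNumber G ∧ ∀ e ∈ M, v ∉ e}

/-- The set `A` of the Gallai–Edmonds decomposition: vertices outside `D` with a
neighbour in `D`. -/
def geA (G : SimpleGraph V) : Set V :=
  {v | v ∉ geD G ∧ ∃ u ∈ geD G, G.Adj v u}

/-- The set `C` of the Gallai–Edmonds decomposition: the remaining vertices. -/
def geC (G : SimpleGraph V) : Set V :=
  {v | v ∉ geD G ∧ v ∉ geA G}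

/-- `G` is an `s`-connector: any two disjoint vertex sets of size at least `s`
are joined by an edge. -/
def IsConnector (G : SimpleGraph V) (s : ℕ) : Prop :=
  ∀ X Y : Set V, Disjoint X Y → s ≤ X.ncard → s ≤ Y.ncard →
    ∃ x ∈ X, ∃ y ∈ Y, G.Adj x y

/-- `G → (t₁K₂, …, t_qK₂)`: every `q`-colouring of the edges of `G` admits a colour
`j` and a `j`-monochromatic matching of size `t j`. -/
def ArrowsMatch (G : SimpleGraph V) {q : ℕ} (t : Fin q → ℕ) : Prop :=
  ∀ c : Sym2 V → Fin q, ∃ j : Fin q, ∃ M : Finset (Sym2 V),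
    IsMatchingSet G M ∧ M.card = t j ∧ ∀ e ∈ M, c e = j

/-- The induced subgraph `G[S]`, viewed as a graph on the same vertex set. -/
def inducedOn (G : SimpleGraph V) (S : Set V) : SimpleGraph V where
  Adj a b := G.Adj a b ∧ a ∈ S ∧ b ∈ S
  symm := ⟨fun _ _ ⟨h, ha, hb⟩ => ⟨h.symm, hb, ha⟩⟩
  loopless := ⟨fun a h => G.loopless.irrefl a h.1⟩

/-- Remove from `G` every edge incident to `S`. -/
def removeIncident (G : SimpleGraph V) (S : Set V) : SimpleGraph V where
  Adj a b := G.Adj a b ∧ a ∉ S ∧ b ∉ S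
  symm := ⟨fun _ _ ⟨h, ha, hb⟩ => ⟨h.symm, hb, ha⟩⟩
  loopless := ⟨fun a h => G.loopless.irrefl a h.1⟩

/-- The subgraph of `G` consisting of the edges incident to `S`. -/
def incidentSub (G : SimpleGraph V) (S : Set V) : SimpleGraph V where
  Adj a b := G.Adj a b ∧ (a ∈ S ∨ b ∈ S)
  symm := ⟨fun _ _ ⟨h, hs⟩ => ⟨h.symm, hs.symm⟩⟩
  loopless := ⟨fun a h => G.loopless.irrefl a h.1⟩

/-- The vertex set of the connected component of `v` in `G`. -/
def compSet (G : SimpleGraph V) (v : V) : Set V := {u | G.Reachable u v}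

/-- The family of vertex sets of the connected components of `G[S]` meeting `S`. -/
def compsOn (G : SimpleGraph V) (S : Set V) : Set (Set V) :=
  {K | ∃ v ∈ S, K = compSet (inducedOn G S) v}

/-- `G[S]` is factor-critical: for every `v ∈ S` there is a matching of `G[S]`
avoiding `v` and covering all other vertices of `S`. -/
def IsFactorCriticalOn (G : SimpleGraph V) (S : Set V) : Prop :=
  ∀ v ∈ S, ∃ M : Finset (Sym2 V), IsMatchingSet (inducedOn G S) M ∧
    (∀ e ∈ M, v ∉ e) ∧ ∀ u ∈ S, u ≠ v → ∃ e ∈ M, u ∈ e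

/-- The bipartite incidence graph of an indexed (multi)hypergraph. -/
def incGraph {ι : Type*} (E : ι → Set V) : SimpleGraph (V ⊕ ι) where
  Adj x y :=
    (∃ v i, x = Sum.inl v ∧ y = Sum.inr i ∧ v ∈ E i) ∨
    (∃ v i, x = Sum.inr i ∧ y = Sum.inl v ∧ v ∈ E i)
  symm := by
    constructor
    rintro x y (⟨v, i, rfl, rfl, h⟩ | ⟨v, i, rfl, rfl, h⟩)
    · exact Or.inr ⟨v, i, rfl, rfl, h⟩
    · exact Or.inl ⟨v, i, rfl, rfl, h⟩
  loopless := by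
    constructor
    rintro x (⟨v, i, rfl, h, -⟩ | ⟨v, i, rfl, h, -⟩) <;> simp at h

/-- An indexed (multi)hypergraph is a hyperforest if its incidence graph has no cycle. -/
def IsHyperforest {ι : Type*} (E : ι → Set V) : Prop := (incGraph E).IsAcyclic

/-- Index type of the multihypergraph `𝒞(𝒢)` of monochromatic connected components:
a colour together with the vertex set of a component of that colour graph. -/
def CompIdx {q : ℕ} (Gc : Fin q → SimpleGraph V) : Type _ :=
  Σ j : Fin q, {K : Set V // ∃ v : V, K = compSet (Gc j) v}

/-- The hyperedges of the multihypergraph `𝒞(𝒢)`. -/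
def CompEdge {q : ℕ} (Gc : Fin q → SimpleGraph V) : CompIdx Gc → Set V :=
  fun p => (p.2 : Set V)

/-- A coloured graph is acyclic if `𝒞(𝒢)` is a hyperforest. -/
def ColouringAcyclic {q : ℕ} (Gc : Fin q → SimpleGraph V) : Prop :=
  IsHyperforest (CompEdge Gc)

/-- `(G₀, G₁, …, G_q)` is a `q`-multicolouring of `G`: the union of all
(coloured and uncoloured) edge sets is the edge set of `G`. -/
def IsMulticolouring (G G0 : SimpleGraph V) {q : ℕ} (Gc : Fin q → SimpleGraph V) : Prop :=
  G0 ⊔ (⨆ j, Gc j) = G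

/-- The colouring `(G₀, G₁, …, G_q)` of `G` is `S`-proper: the uncoloured edges are
exactly the edges of `G` incident to `S`, and they carry no colour. -/
def IsSProper (G G0 : SimpleGraph V) {q : ℕ} (Gc : Fin q → SimpleGraph V) (S : Set V) : Prop :=
  G0.edgeSet = {e | e ∈ G.edgeSet ∧ ∃ v ∈ S, v ∈ e} ∧
    ∀ j, Disjoint G0.edgeSet (Gc j).edgeSet

/-- The potential `σ_𝒢(T) = r_𝒢(T) - |T|`, where
`r_𝒢(T) = ∑_j |A_j ∩ T| + ∑_j ∑_i (ν(G_j[K_j^i]) - ν(G_j[K_j^i ∖ T]))`,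
the inner sum running over the components `K_j^i` of `G_j[D_j]`. -/
noncomputable def sigmaCol {q : ℕ} (Gc : Fin q → SimpleGraph V) (T : Set V) : ℤ :=
  ((∑ j : Fin q, ((geA (Gc j) ∩ T).ncard : ℤ))
    + ∑ j : Fin q, ∑ᶠ K ∈ compsOn (Gc j) (geD (Gc j)),
        ((matchingNumber (inducedOn (Gc j) K) : ℤ)
          - (matchingNumber (inducedOn (Gc j) (K \ T)) : ℤ)))
    - (T.ncard : ℤ)

/-- `T` is `σ_𝒢`-maximal. -/
def SigmaMaximal {q : ℕ} (Gc : Fin q → SimpleGraph V) (T : Set V) : Prop :=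
  (∀ S : Set V, sigmaCol Gc S ≤ sigmaCol Gc T) ∧
    ∀ T' : Set V, T ⊂ T' → sigmaCol Gc T' < sigmaCol Gc T

open Finset

theorem exists_insert_transition {β : Type*} [Fintype β] [DecidableEq β]
    (P : Finset β → Prop) (h0 : P ∅) (h1 : ¬ P univ) :
    ∃ S p, P S ∧ ¬ P (insert p S) := by
  by_contra! h
  exact h1 (Finset.induction_on (motive := P) univ h0 fun p S _ hS => h S p hS)

section Intersecting

variable {α β : Type*} [DecidableEq β]

theorem card_filter_mem_add_compl [Fintype β] (X : Finset α) (l : α → β) (S : Finset β) :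
    #{x ∈ X | l x ∈ S} + #{x ∈ X | l x ∈ Sᶜ} = #X := by
  simp only [mem_compl]
  exact card_filter_add_card_filter_not (s := X) (fun x => l x ∈ S)

theorem card_filter_mem_insert_le [DecidableEq α] (X : Finset α) (l : α → β)
    (S : Finset β) (p : β) :
    #{x ∈ X | l x ∈ insert p S} ≤ #{x ∈ X | l x = p} + #{x ∈ X | l x ∈ S} := by
  refine le_trans (card_le_card ?_) (card_union_le _ _)
  intro x
  simp only [mem_filter, mem_insert, mem_union]
  tauto

/-- A bipartite multigraph with edge set `X` and maximum degree `D`, in which any two sets of more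
than `s` edges contain two edges sharing an endpoint, has at most `D + 4 * s` edges. -/
theorem card_le_of_bipartite_intersecting [DecidableEq α] [Fintype β] (X : Finset α)
    (l r : α → β) (s D : ℕ)
    (hI : ∀ Y ⊆ X, ∀ Z ⊆ X, s < #Y → s < #Z → ∃ y ∈ Y, ∃ z ∈ Z, l y = l z ∨ r y = r z)
    (hl : ∀ p, #{x ∈ X | l x = p} ≤ D) (hr : ∀ p, #{x ∈ X | r x = p} ≤ D) :
    #X ≤ D + 4 * s := by
  by_contra! hX
  obtain ⟨S, p, hS, hp⟩ := exists_insert_transition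
    (fun S => #{x ∈ X | l x ∈ S} ≤ 2 * s) (by simp) (by simp; omega)
  have h1 := card_filter_mem_insert_le X l S p
  have h2 := card_filter_mem_add_compl X l (insert p S)
  have h3 := hl p
  set E₁ := {x ∈ X | l x ∈ insert p S} with hE₁
  set E₂ := {x ∈ X | l x ∈ (insert p S)ᶜ} with hE₂
  have key : ∀ T : Finset β, #{x ∈ E₁ | r x ∈ T} ≤ s ∨ #{x ∈ E₂ | r x ∈ Tᶜ} ≤ s := by
    intro T
    by_contra! h
    obtain ⟨y, hy, z, hz, hyz⟩ := hI _ ((filter_subset _ _).trans (filter_subset _ _)) _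
      ((filter_subset _ _).trans (filter_subset _ _)) h.1 h.2
    simp only [mem_filter] at hy
    simp only [mem_filter, mem_compl] at hz
    rcases hyz with h | h
    · exact hz.1.2 (h ▸ hy.1.2)
    · exact hz.2 (h ▸ hy.2)
  obtain ⟨T, p', hT, hp'⟩ := exists_insert_transition
    (fun T => #{x ∈ X | r x ∈ T} ≤ 2 * s) (by simp) (by simp; omega)
  have split : ∀ T : Finset β,
      #{x ∈ X | r x ∈ T} = #{x ∈ E₁ | r x ∈ T} + #{x ∈ E₂ | r x ∈ T} := by
    intro T
    have := card_filter_mem_add_compl {x ∈ X | r x ∈ T} l (insert p S)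
    rw [← this, hE₁, hE₂, filter_comm, filter_comm (p := fun x => r x ∈ T)]
  have k1 := key (insert p' T)
  have k2 := key (insert p' T)ᶜ
  rw [compl_compl] at k2
  have h4 := card_filter_mem_insert_le X r T p'
  have h5 := card_filter_mem_add_compl X r (insert p' T)
  have h6 := card_filter_mem_add_compl E₁ r (insert p' T)
  have h7 := card_filter_mem_add_compl E₂ r (insert p' T)
  have h8 := split (insert p' T)
  have h9 := split (insert p' T)ᶜ
  have h10 := hr p'
  omega

/-- A multigraph with edge set `X` and maximum degree `D`, in which any two sets of more
than `s` edges contain two edges sharing an endpoint, has at most `2 * D + 6 * s` edges. -/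
theorem card_le_of_intersecting [DecidableEq α] [Fintype β] (X : Finset α) (f g : α → β) (s D : ℕ)
    (hI : ∀ Y ⊆ X, ∀ Z ⊆ X, s < #Y → s < #Z →
      ∃ y ∈ Y, ∃ z ∈ Z, f y = f z ∨ f y = g z ∨ g y = f z ∨ g y = g z)
    (hD : ∀ p, #{x ∈ X | f x = p ∨ g x = p} ≤ D) :
    #X ≤ 2 * D + 6 * s := by
  by_contra! hX
  obtain ⟨S, p, hS, hp⟩ := exists_insert_transition
    (fun S => #{x ∈ X | f x ∈ S ∧ g x ∈ S} ≤ s) (by simp) (by simp; omega)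
  have hT : #{x ∈ X | f x ∈ (insert p S)ᶜ ∧ g x ∈ (insert p S)ᶜ} ≤ s := by
    by_contra! h
    obtain ⟨y, hy, z, hz, hyz⟩ := hI _ (filter_subset _ _) _ (filter_subset _ _)
      (not_le.1 hp) h
    simp only [mem_filter, mem_compl] at hy hz
    rcases hyz with h | h | h | h
    · exact hz.2.1 (h ▸ hy.2.1)
    · exact hz.2.2 (h ▸ hy.2.1)
    · exact hz.2.1 (h ▸ hy.2.2)
    · exact hz.2.2 (h ▸ hy.2.2)
  set X' := {x ∈ X | (f x ∈ S ∧ g x ∈ (insert p S)ᶜ) ∨ (f x ∈ (insert p S)ᶜ ∧ g x ∈ S)} with hX'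
  have hsub : X' ⊆ X := filter_subset _ _
  have hcover : #X ≤ #{x ∈ X | f x ∈ S ∧ g x ∈ S} +
      #{x ∈ X | f x ∈ (insert p S)ᶜ ∧ g x ∈ (insert p S)ᶜ} +
      #{x ∈ X | f x = p ∨ g x = p} + #X' := by
    refine le_trans (card_le_card ?_) ((card_union_le _ _).trans (Nat.add_le_add_right
      ((card_union_le _ _).trans (Nat.add_le_add_right (card_union_le _ _) _)) _))
    intro x hx
    simp only [hX', mem_union, mem_filter, mem_compl, mem_insert]
    tauto
  have hbip := card_le_of_bipartite_intersecting X' (fun x => if f x ∈ S then f x else g x)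
    (fun x => if f x ∈ S then g x else f x) s D ?_ ?_ ?_
  · have := hD p
    omega
  · intro Y hY Z hZ hYs hZs
    obtain ⟨y, hy, z, hz, hyz⟩ := hI Y (hY.trans hsub) Z (hZ.trans hsub) hYs hZs
    refine ⟨y, hy, z, hz, ?_⟩
    have hy' := hY hy
    have hz' := hZ hz
    simp only [hX', mem_filter, mem_compl, mem_insert] at hy' hz'
    by_cases h1 : f y ∈ S <;> by_cases h2 : f z ∈ S <;> simp only [h1, h2, if_true, if_false] <;>
      grind
  all_goals
    intro p'
    refine le_trans (card_le_card fun x hx => ?_) (hD p')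
    simp only [mem_filter] at hx ⊢
    refine ⟨hsub hx.1, ?_⟩
    have := hx.2
    split_ifs at this <;> tauto

end Intersecting

section Partitions

variable {α β : Type*} [Fintype α] [Fintype β] [DecidableEq β] {q : ℕ}

theorem card_le_sum_half_fibers (L : α → β) (C : Finset α)
    (hC : ∀ k, #{x ∈ C | L x = k} ≤ #{x | L x = k} / 2) :
    #C ≤ ∑ k, #{x | L x = k} / 2 := by
  rw [card_eq_sum_card_fiberwise (f := L) (t := univ) (by simp)]
  exact sum_le_sum fun k _ => hC k

/-- The case of `card_le_sum_half_parts` in which one part contains almost half of the elements: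
the smaller sides of the other parts form a vertex cover between that part and its complement. -/
theorem card_le_of_large_part [DecidableEq α] (s : ℕ) (L : Fin q → α → β)
    (H : ∀ X Y : Finset α, Disjoint X Y → s < #X → s < #Y →
      ∃ x ∈ X, ∃ y ∈ Y, ∃ j, L j x = L j y)
    (i : Fin q) (k : β) (c : ℕ) (hk : Fintype.card α ≤ 2 * #{x | L i x = k} + c) :
    Fintype.card α ≤ ∑ j, ∑ k, #{x | L j x = k} / 2 + ∑ k, #{x | L i x = k} / 2 + 1 + (s + c) := by
  set K : Finset α := {x | L i x = k} with hK
  let C : Fin q → Finset α := fun j =>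
    {u | if #{x ∈ K | L j x = L j u} ≤ #{x ∈ Kᶜ | L j x = L j u} then u ∈ K else u ∈ Kᶜ}
  have hC : ∀ j, #(C j) ≤ ∑ k, #{x | L j x = k} / 2 := by
    intro j
    refine card_le_sum_half_fibers _ _ fun k => ?_
    have h1 : #{x ∈ K | L j x = k} + #{x ∈ Kᶜ | L j x = k} = #{x | L j x = k} := by
      rw [← card_union_of_disjoint
        (disjoint_filter_filter disjoint_compl_right), ← filter_union, union_compl]
    have h2 : #{x ∈ C j | L j x = k} ≤ min #{x ∈ K | L j x = k} #{x ∈ Kᶜ | L j x = k} := by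
      by_cases h : #{x ∈ K | L j x = k} ≤ #{x ∈ Kᶜ | L j x = k}
      · rw [min_eq_left h]
        refine card_le_card fun x hx => ?_
        simp only [C, mem_filter, mem_univ, true_and] at hx ⊢
        obtain ⟨hx, rfl⟩ := hx
        rw [if_pos h] at hx
        exact ⟨hx, rfl⟩
      · rw [min_eq_right (by omega)]
        refine card_le_card fun x hx => ?_
        simp only [C, mem_filter, mem_univ, true_and] at hx ⊢
        obtain ⟨hx, rfl⟩ := hx
        rw [if_neg h] at hx
        exact ⟨hx, rfl⟩
    omega
  set D := (univ.erase i).biUnion C with hD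
  have hDcard : #D + ∑ k, #{x | L i x = k} / 2 ≤ ∑ j, ∑ k, #{x | L j x = k} / 2 := by
    rw [← sum_erase_add univ _ (mem_univ i)]
    exact Nat.add_le_add_right (card_biUnion_le.trans (sum_le_sum fun j _ => hC j)) _
  have hKF : #K / 2 ≤ ∑ k, #{x | L i x = k} / 2 :=
    single_le_sum (f := fun k => #{x | L i x = k} / 2) (fun _ _ => Nat.zero_le _) (mem_univ k)
  have hsmall : #(K \ D) ≤ s ∨ #(Kᶜ \ D) ≤ s := by
    by_contra! h
    obtain ⟨x, hx, y, hy, j, hj⟩ := H _ _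
      (disjoint_compl_right.mono sdiff_subset sdiff_subset) h.1 h.2
    rw [mem_sdiff] at hx hy
    have hji : j ≠ i := by
      rintro rfl
      simp only [hK, mem_compl, mem_filter, mem_univ, true_and] at *
      exact hy.1 (hj ▸ hx.1)
    have hxC : x ∉ C j := fun h => hx.2 (mem_biUnion.2 ⟨j, by simp [hji], h⟩)
    have hyC : y ∉ C j := fun h => hy.2 (mem_biUnion.2 ⟨j, by simp [hji], h⟩)
    simp only [C, mem_filter, mem_univ, true_and, hj] at hxC hyC
    split_ifs at hxC hyC
    · exact hxC hx.1
    · exact hyC hy.1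
  have h1 := card_sdiff_add_card K D
  have h2 := card_sdiff_add_card Kᶜ D
  have h3 := card_le_card (subset_union_left : K ⊆ K ∪ D)
  have h4 := card_le_card (subset_union_left : Kᶜ ⊆ Kᶜ ∪ D)
  have h5 := card_add_card_compl K
  omega

/-- If all parts are small, then few elements of a given part of colour `i` have singleton parts in
all colours except `i` and `j`. -/
theorem card_part_of_two_colours_le [DecidableEq α] (s : ℕ) (L : Fin q → α → β)
    (H : ∀ X Y : Finset α, Disjoint X Y → s < #X → s < #Y →
      ∃ x ∈ X, ∃ y ∈ Y, ∃ j, L j x = L j y)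
    (hL : ∀ j k, 2 * #{x | L j x = k} + 2 * s < Fintype.card α) (i j : Fin q) (k : β)
    (Z : Finset α)
    (hZ : ∀ x ∈ Z, L i x = k ∧ ∀ j', j' ≠ i → j' ≠ j → ∀ y, L j' x = L j' y → x = y) :
    #Z ≤ 2 * s := by
  by_contra! hs
  have key : ∀ S : Finset β, s < #{x ∈ Z | L j x ∈ S} →
      #{v | L i v ≠ k ∧ L j v ∈ Sᶜ} ≤ s := by
    intro S hS
    by_contra! h
    have hdisj : Disjoint {x ∈ Z | L j x ∈ S} ({v | L i v ≠ k ∧ L j v ∈ Sᶜ} : Finset α) := by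
      rw [Finset.disjoint_left]
      intro x hx hx'
      simp only [mem_filter, mem_univ, true_and] at hx hx'
      exact hx'.1 (hZ x hx.1).1
    obtain ⟨x, hx, y, hy, j', hj'⟩ := H _ _ hdisj hS h
    have hne : x ≠ y := fun h => (Finset.disjoint_left.1 hdisj) hx (h ▸ hy)
    simp only [mem_filter, mem_univ, true_and, mem_compl] at hx hy
    refine hne ((hZ x hx.1).2 j' ?_ ?_ y hj')
    · rintro rfl
      exact hy.1 (hj' ▸ (hZ x hx.1).1)
    · rintro rfl
      exact hy.2 (hj' ▸ hx.2)
  obtain ⟨S, p, hS, hp⟩ := exists_insert_transition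
    (fun S => #{x ∈ Z | L j x ∈ S} ≤ s) (by simp) (by simp; omega)
  have h1 := key _ (not_le.1 hp)
  have h2 := key Sᶜ (by have := card_filter_mem_add_compl Z (L j) S; omega)
  rw [compl_compl] at h2
  have hcover : #(univ : Finset α) ≤ #{v | L i v = k} + #{v | L j v = p} +
      #{v | L i v ≠ k ∧ L j v ∈ (insert p S)ᶜ} + #{v | L i v ≠ k ∧ L j v ∈ S} := by
    refine le_trans (card_le_card ?_) ((card_union_le _ _).trans (Nat.add_le_add_right
      ((card_union_le _ _).trans (Nat.add_le_add_right (card_union_le _ _) _)) _))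
    intro x _
    simp only [mem_union, mem_filter, mem_univ, true_and, mem_compl, mem_insert]
    tauto
  rw [card_univ] at hcover
  have := hL i k
  have := hL j p
  omega

/-- If all parts are small, then few elements have at most two nontrivial parts. -/
theorem card_two_colour_vertices_le [DecidableEq α] (s : ℕ) (L : Fin q → α → β)
    (H : ∀ X Y : Finset α, Disjoint X Y → s < #X → s < #Y →
      ∃ x ∈ X, ∃ y ∈ Y, ∃ j, L j x = L j y)
    (hL : ∀ j k, 2 * #{x | L j x = k} + 2 * s < Fintype.card α)
    (X : Finset α)
    (hX : ∀ x ∈ X, ∃ a b, ∀ j, j ≠ a → j ≠ b → ∀ y, L j x = L j y → x = y) :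
    #X ≤ 4 * q * s + 6 * s := by
  classical
  obtain rfl | ⟨x₀, hx₀⟩ := X.eq_empty_or_nonempty
  · simp
  have i₀ : Fin q := (hX x₀ hx₀).choose
  have : ∀ x, ∃ a b, x ∈ X → ∀ j, j ≠ a → j ≠ b → ∀ y, L j x = L j y → x = y := by
    intro x
    by_cases hx : x ∈ X
    · obtain ⟨a, b, h⟩ := hX x hx
      exact ⟨a, b, fun _ => h⟩
    · exact ⟨i₀, i₀, fun h => absurd h hx⟩
  choose a b hab using this
  have main := card_le_of_intersecting X (fun x => (a x, L (a x) x)) (fun x => (b x, L (b x) x))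
    s (2 * q * s) ?_ ?_
  · linarith
  · intro Y hY Z hZ hYs hZs
    by_cases hd : Disjoint Y Z
    · obtain ⟨y, hy, z, hz, j, hj⟩ := H Y Z hd hYs hZs
      have hne : y ≠ z := fun h => (Finset.disjoint_left.1 hd) hy (h ▸ hz)
      have h1 : j = a y ∨ j = b y := by
        by_contra! h
        exact hne (hab y (hY hy) j h.1 h.2 z hj)
      have h2 : j = a z ∨ j = b z := by
        by_contra! h
        exact hne (hab z (hZ hz) j h.1 h.2 y hj.symm).symm
      refine ⟨y, hy, z, hz, ?_⟩
      simp only [Prod.mk.injEq]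
      grind
    · rw [Finset.not_disjoint_iff] at hd
      obtain ⟨y, hy, hz⟩ := hd
      exact ⟨y, hy, y, hz, Or.inl rfl⟩
  · rintro ⟨i, k⟩
    have hsub : ({x ∈ X | (a x, L (a x) x) = (i, k) ∨ (b x, L (b x) x) = (i, k)} : Finset α) ⊆
        univ.biUnion fun j => {x | L i x = k ∧
          ∀ j', j' ≠ i → j' ≠ j → ∀ y, L j' x = L j' y → x = y} := by
      intro x hx
      simp only [mem_filter, Prod.mk.injEq] at hx
      simp only [mem_biUnion, mem_univ, true_and, mem_filter]
      rcases hx with ⟨hx, ⟨rfl, h⟩ | ⟨rfl, h⟩⟩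
      · exact ⟨b x, h, hab x hx⟩
      · exact ⟨a x, h, fun j h1 h2 => hab x hx j h2 h1⟩
    refine (card_le_card hsub).trans (card_biUnion_le.trans ?_)
    refine (sum_le_card_nsmul _ _ (2 * s) fun j _ => ?_).trans ?_
    · exact card_part_of_two_colours_le s L H hL i j k _ fun x hx => by simpa using hx
    · simp only [card_univ, Fintype.card_fin, smul_eq_mul]
      linarith

theorem card_le_three_mul_sum_half (L : α → β) (N : Finset α)
    (hN : ∀ x ∈ N, ∃ y, L x = L y ∧ x ≠ y) :
    #N ≤ 3 * ∑ k, #{x | L x = k} / 2 := by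
  rw [card_eq_sum_card_fiberwise (f := L) (t := univ) (by simp), mul_sum]
  refine sum_le_sum fun k _ => ?_
  have h1 : #{x ∈ N | L x = k} ≤ #{x | L x = k} :=
    card_le_card (filter_subset_filter _ (subset_univ _))
  rcases ({x ∈ N | L x = k} : Finset α).eq_empty_or_nonempty with h | ⟨x, hx⟩
  · simp [h]
  · rw [mem_filter] at hx
    obtain ⟨y, hy, hne⟩ := hN x hx.1
    have : 1 < #{x | L x = k} :=
      one_lt_card.2 ⟨x, by simp [hx.2], y, by simp [← hy, hx.2], hne⟩
    omega

/-- If `q` partitions of a finite set jointly connect any two disjoint sets of more than `s`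
elements, then the complete graphs on their parts have large total matching number. -/
theorem card_le_sum_half_parts [DecidableEq α] (hq : 1 ≤ q) (s : ℕ) (L : Fin q → α → β)
    (H : ∀ X Y : Finset α, Disjoint X Y → s < #X → s < #Y →
      ∃ x ∈ X, ∃ y ∈ Y, ∃ j, L j x = L j y)
    (M : ℕ) (hM : ∀ j, ∑ k, #{x | L j x = k} / 2 ≤ M) :
    Fintype.card α ≤ ∑ j, ∑ k, #{x | L j x = k} / 2 + M + 1 + 7 * (q + 1) * s := by
  classical
  by_cases hbig : ∃ i k, Fintype.card α ≤ 2 * #{x | L i x = k} + 2 * s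
  · obtain ⟨i, k, hk⟩ := hbig
    have := card_le_of_large_part s L H i k _ hk
    have := hM i
    nlinarith [Nat.zero_le (q * s)]
  · push Not at hbig
    set X : Finset α := {x | ∃ a b, ∀ j, j ≠ a → j ≠ b → ∀ y, L j x = L j y → x = y} with hX
    have hXcard := card_two_colour_vertices_le s L H hbig X (fun x hx => by simpa [hX] using hx)
    have hdeg : ∀ x ∈ Xᶜ, 3 ≤ #{j | ∃ y, L j x = L j y ∧ x ≠ y} := by
      intro x hx
      simp only [hX, mem_compl, mem_filter, mem_univ, true_and] at hx
      by_contra! hlt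
      apply hx
      have hfin : ∃ a b, ({j | ∃ y, L j x = L j y ∧ x ≠ y} : Finset (Fin q)) ⊆ {a, b} := by
        have h3 : #{j | ∃ y, L j x = L j y ∧ x ≠ y} = 0 ∨ #{j | ∃ y, L j x = L j y ∧ x ≠ y} = 1 ∨
          #{j | ∃ y, L j x = L j y ∧ x ≠ y} = 2 := by omega
        rcases h3 with h | h | h
        · exact ⟨⟨0, hq⟩, ⟨0, hq⟩, by simp [card_eq_zero.1 h]⟩
        · obtain ⟨a, ha⟩ := card_eq_one.1 h
          exact ⟨a, a, by simp [ha]⟩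
        · obtain ⟨a, b, -, hab⟩ := card_eq_two.1 h
          exact ⟨a, b, hab.subset⟩
      obtain ⟨a, b, hab⟩ := hfin
      refine ⟨a, b, fun j ha hb y hy => ?_⟩
      by_contra hne
      have := hab (mem_filter.2 ⟨mem_univ j, y, hy, hne⟩)
      simp [ha, hb] at this
    have hcount : #Xᶜ * 3 ≤ ∑ j, 3 * ∑ k, #{x | L j x = k} / 2 := by
      refine (card_nsmul_le_sum _ _ _ hdeg).trans ?_
      refine (sum_card_bipartiteAbove_eq_sum_card_bipartiteBelow (t := univ)
        (fun x j => ∃ y, L j x = L j y ∧ x ≠ y)).trans_le ?_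
      refine sum_le_sum fun j _ => card_le_three_mul_sum_half _ _ fun x hx => ?_
      exact (mem_filter.1 hx).2
    rw [← mul_sum] at hcount
    have := card_add_card_compl X
    nlinarith [Nat.zero_le (q * s)]

end Partitions

section TutteBerge

/-- The join of `G` with a complete graph on `d` new vertices. -/
def joinComplete {V : Type*} (G : SimpleGraph V) (d : ℕ) : SimpleGraph (V ⊕ Fin d) where
  Adj a b := a ≠ b ∧ ∀ u v, a = Sum.inl u → b = Sum.inl v → G.Adj u v
  symm := ⟨fun _ _ h => ⟨h.1.symm, fun u v hu hv => (h.2 v u hv hu).symm⟩⟩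
  loopless := ⟨fun _ h => h.1 rfl⟩

theorem IsMatchingSet.of_involution {V : Type*} [DecidableEq V] (G : SimpleGraph V)
    (B : Finset V) (p : V → V)
    (hadj : ∀ v ∈ B, G.Adj v (p v)) (hp : ∀ v ∈ B, p (p v) = v) :
    IsMatchingSet G (B.image fun v => s(v, p v)) ∧ #B ≤ 2 * #(B.image fun v => s(v, p v)) := by
  refine ⟨⟨?_, ?_⟩, ?_⟩
  · intro e he
    obtain ⟨v, hv, rfl⟩ := mem_image.1 he
    exact hadj v hv
  · intro e he f hf hne w hwe hwf
    obtain ⟨v, hv, rfl⟩ := mem_image.1 he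
    obtain ⟨u, hu, rfl⟩ := mem_image.1 hf
    have h1 := hp v hv
    have h2 := hp u hu
    apply hne
    rw [Sym2.mem_iff] at hwe hwf
    rw [Sym2.eq_iff]
    grind
  · refine card_le_mul_card_image _ _ fun e he => ?_
    obtain ⟨v, hv, rfl⟩ := mem_image.1 he
    refine (card_le_card (t := {v, p v}) fun u hu => ?_).trans card_le_two
    have := (mem_filter.1 hu).2
    rw [Sym2.eq_iff] at this
    simp only [mem_insert, mem_singleton]
    tauto

theorem IsMatchingSet.subset {V : Type*} {G : SimpleGraph V} {M N : Finset (Sym2 V)}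
    (hM : IsMatchingSet G M) (h : N ⊆ M) : IsMatchingSet G N :=
  ⟨fun e he => hM.1 e (h he), fun e he f hf => hM.2 e (h he) f (h hf)⟩

theorem deleteVerts_top_coe_adj {V : Type*} (G : SimpleGraph V) (U : Set V)
    (a b : ((⊤ : G.Subgraph).deleteVerts U).verts) :
    ((⊤ : G.Subgraph).deleteVerts U).coe.Adj a b ↔ G.Adj a b := by
  have ha := a.2
  have hb := b.2
  simp only [Subgraph.deleteVerts_verts, Set.mem_sdiff] at ha hb
  rw [Subgraph.coe_adj, Subgraph.deleteVerts_adj, Subgraph.top_adj]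
  tauto

variable {V : Type*} [Fintype V] [DecidableEq V]

theorem exists_matchingSet_of_perfect_join (G : SimpleGraph V) (d : ℕ)
    (M : (joinComplete G d).Subgraph) (hM : M.IsPerfectMatching) :
    ∃ N, IsMatchingSet G N ∧ Fintype.card V ≤ 2 * #N + d := by
  classical
  rw [Subgraph.isPerfectMatching_iff] at hM
  choose p hp hpu using hM
  have hpp : ∀ w, p (p w) = w := fun w => (hpu (p w) w (hp w).symm).symm
  let g : V → V := fun v => Sum.elim id (fun _ => v) (p (Sum.inl v))
  let B : Finset V := {v | (p (Sum.inl v)).isLeft}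
  have hg : ∀ v ∈ B, p (Sum.inl v) = Sum.inl (g v) := by
    intro v hv
    obtain ⟨u, hu⟩ := Sum.isLeft_iff.1 (mem_filter.1 hv).2
    simp [g, hu]
  have hBc : #Bᶜ ≤ d := by
    rcases (Bᶜ).eq_empty_or_nonempty with h | ⟨v₀, hv₀⟩
    · simp [h]
    have hr : ∀ v ∈ Bᶜ, ∃ i, p (Sum.inl v) = Sum.inr i := by
      intro v hv
      simpa [B, Sum.isRight_iff] using hv
    have : Nonempty (Fin d) := ⟨(hr v₀ hv₀).choose⟩
    choose! r hr using hr
    have := card_le_card_of_injOn (s := Bᶜ) (t := univ) r (by simp) (fun u hu v hv huv => by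
      have h := hr u hu
      rw [huv, ← hr v hv] at h
      have := congrArg p h
      rw [hpp, hpp] at this
      exact Sum.inl_injective this)
    simpa using this
  obtain ⟨h1, h2⟩ := IsMatchingSet.of_involution G B g
    (fun v hv => (M.adj_sub (hp (Sum.inl v))).2 v (g v) rfl (hg v hv)) (fun v hv => by
      have h := hpp (Sum.inl v)
      rw [hg v hv] at h
      simp [g, h])
  have := card_add_card_compl B
  exact ⟨_, h1, by omega⟩

theorem forall_inr_mem_of_violator (G : SimpleGraph V) (d : ℕ)
    (hev : Even (Fintype.card V + d)) (U : Set (V ⊕ Fin d))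
    (hU : (joinComplete G d).IsTutteViolator U) (i : Fin d) : Sum.inr i ∈ U := by
  classical
  by_contra hi
  unfold IsTutteViolator at hU
  set H := ((⊤ : (joinComplete G d).Subgraph).deleteVerts U).coe
  let w₀ : ((⊤ : (joinComplete G d).Subgraph).deleteVerts U).verts := ⟨Sum.inr i, by simp [hi]⟩
  have hreach : ∀ w, H.connectedComponentMk w = H.connectedComponentMk w₀ := by
    intro w
    by_cases hw : w = w₀
    · rw [hw]
    · refine ConnectedComponent.sound (Adj.reachable ?_)
      have hne : w.1 ≠ Sum.inr i := fun h => hw (Subtype.ext h)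
      rw [deleteVerts_top_coe_adj]
      exact ⟨hne, fun u v _ hv => by simp [w₀] at hv⟩
  have hsub : Subsingleton H.ConnectedComponent := by
    refine ⟨fun c c' => ?_⟩
    induction c using ConnectedComponent.ind
    induction c' using ConnectedComponent.ind
    exact (hreach _).trans (hreach _).symm
  have h1 : H.oddComponents.ncard ≤ 1 := Set.ncard_le_one_of_subsingleton _
  have hU0 : U = ∅ := (Set.ncard_eq_zero U.toFinite).1 (by omega)
  have hodd : Odd H.oddComponents.ncard := by
    rw [show H.oddComponents.ncard = 1 by omega]
    exact odd_one
  rw [odd_ncard_oddComponents] at hodd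
  rw [← Nat.not_odd_iff_even] at hev
  apply hev
  have : Nat.card ((⊤ : (joinComplete G d).Subgraph).deleteVerts U).verts =
      Fintype.card V + d := by
    simp [hU0]
  rwa [this] at hodd

theorem sum_half_fibers_add_odd (A : Finset V) (L : V → V) :
    2 * ∑ k, #{x ∈ A | L x = k} / 2 + #{k | Odd #{x ∈ A | L x = k}} = #A := by
  rw [card_filter, mul_sum, ← sum_add_distrib,
    card_eq_sum_card_fiberwise (s := A) (f := L) (t := univ) (by simp)]
  refine sum_congr rfl fun k _ => ?_
  split_ifs with h
  · exact Nat.two_mul_div_two_add_one_of_odd h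
  · exact Nat.two_mul_div_two_of_even (Nat.not_odd_iff_even.1 h)

/-- The nontrivial inequality of the Tutte–Berge formula: a graph without a matching of size `t`
has a vertex set `A` such that `A` together with a labelling of the other vertices, constant on the
components of `G - A`, certifies the absence of such a matching. -/
theorem exists_tutteBerge_barrier (G : SimpleGraph V) (t : ℕ) (h2 : 2 * t ≤ Fintype.card V)
    (hM : ∀ M : Finset (Sym2 V), IsMatchingSet G M → #M ≠ t) :
    ∃ (A : Finset V) (L : V → V), (∀ u v, G.Adj u v → u ∉ A → v ∉ A → L u = L v) ∧
      #A + ∑ k, #{x ∈ Aᶜ | L x = k} / 2 < t := by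
  classical
  set d := Fintype.card V - 2 * t with hd
  have hev : Even (Fintype.card V + d) := ⟨Fintype.card V - t, by omega⟩
  obtain ⟨U, hU⟩ := exists_isTutteViolator (G := joinComplete G d) (fun M hPM => by
    obtain ⟨N, hN, hcard⟩ := exists_matchingSet_of_perfect_join G d M hPM
    obtain ⟨N', hN', hc⟩ := exists_subset_card_eq (show t ≤ #N by omega)
    exact hM N' (hN.subset hN') hc) (by simpa using hev)
  have hinr := forall_inr_mem_of_violator G d hev U hU
  unfold IsTutteViolator at hU
  set H := ((⊤ : (joinComplete G d).Subgraph).deleteVerts U).coe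
  have hmem : ∀ v, Sum.inl v ∉ U →
      Sum.inl v ∈ ((⊤ : (joinComplete G d).Subgraph).deleteVerts U).verts := by
    intro v hv
    simp [hv]
  have hrep : ∀ c : H.ConnectedComponent, ∃ v, ∃ hv : Sum.inl v ∉ U,
      H.connectedComponentMk ⟨Sum.inl v, hmem v hv⟩ = c := by
    intro c
    induction c using ConnectedComponent.ind with
    | h w =>
      obtain ⟨w | i, hw⟩ := w
      · exact ⟨w, by simpa using hw, rfl⟩
      · simp [hinr i] at hw
  choose r hrU hr using hrep
  have hrinj : Function.Injective r := by
    intro c c' h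
    rw [← hr c, ← hr c']
    simp only [h]
  let A : Finset V := {v | Sum.inl v ∈ U}
  let L : V → V := fun v =>
    if hv : Sum.inl v ∉ U then r (H.connectedComponentMk ⟨Sum.inl v, hmem v hv⟩) else v
  refine ⟨A, L, ?_, ?_⟩
  · intro u v huv hu hv
    have hu' : Sum.inl u ∉ U := by simpa [A] using hu
    have hv' : Sum.inl v ∉ U := by simpa [A] using hv
    simp only [L, dif_pos hu', dif_pos hv']
    congr 1
    refine ConnectedComponent.sound (Adj.reachable ?_)
    rw [deleteVerts_top_coe_adj]
    exact ⟨by simpa using huv.ne, fun _ _ h h' => Sum.inl_injective h ▸ Sum.inl_injective h' ▸ huv⟩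
  · have hUcard : #A + d ≤ U.ncard := by
      have hsub : (((A.disjSum univ : Finset (V ⊕ Fin d))) : Set (V ⊕ Fin d)) ⊆ U := by
        rintro (v | i) hw
        · simpa [A] using hw
        · exact hinr i
      have := Set.ncard_le_ncard hsub U.toFinite
      rwa [Set.ncard_coe_finset, card_disjSum, card_univ, Fintype.card_fin] at this
    have hfiber : ∀ c : H.ConnectedComponent, #{x ∈ Aᶜ | L x = r c} = c.supp.ncard := by
      intro c
      rw [← Set.ncard_coe_finset, ← Set.ncard_image_of_injective _ (Sum.inl_injective (β := Fin d)),
        ← Set.ncard_image_of_injective c.supp Subtype.val_injective]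
      congr 1
      ext w
      constructor
      · rintro ⟨v, hv, rfl⟩
        simp only [coe_filter, mem_compl, Set.mem_ofPred_eq] at hv
        have hv' : Sum.inl v ∉ U := by simpa [A] using hv.1
        refine ⟨⟨Sum.inl v, hmem v hv'⟩, ?_, rfl⟩
        have h := hv.2
        simp only [L, dif_pos hv'] at h
        exact hrinj h
      · rintro ⟨⟨v | i, hw⟩, hc, rfl⟩
        · have hv' : Sum.inl v ∉ U := by simpa using hw
          refine ⟨v, ?_, rfl⟩
          simp only [coe_filter, mem_compl, Set.mem_ofPred_eq]
          refine ⟨by simpa [A] using hv', ?_⟩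
          simp only [L, dif_pos hv']
          exact congrArg r hc
        · simp [hinr i] at hw
    have hodd : H.oddComponents.ncard ≤ #{k | Odd #{x ∈ Aᶜ | L x = k}} := by
      rw [← Set.ncard_coe_finset, ← Set.ncard_image_of_injective _ hrinj]
      refine Set.ncard_le_ncard ?_ (Set.toFinite _)
      rintro _ ⟨c, hc, rfl⟩
      simp only [coe_filter, mem_univ, true_and, Set.mem_ofPred_eq]
      rw [hfiber]
      exact hc
    have h1 := sum_half_fibers_add_odd Aᶜ L
    have h3 := card_add_card_compl A
    omega

end TutteBerge

/-- **Theorem 1 (main theorem).** If `q, s ≥ 1`, `t ∈ ℕ₊^q`, and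
`n ≥ ‖t‖_∞ + Λ_t + 1 + 7(q+1)(s-1)`, then every `n`-vertex `s`-connector `G`
satisfies `G → tK₂`. -/
theorem main_theorem {q s : ℕ} (hq : 1 ≤ q) (hs : 1 ≤ s)
    (t : Fin q → ℕ) (ht : ∀ j, 1 ≤ t j)
    {V : Type*} [Fintype V]
    (hn : Finset.univ.sup t + (∑ j, (t j - 1)) + 1 + 7 * (q + 1) * (s - 1) ≤ Fintype.card V)
    (G : SimpleGraph V) (hG : IsConnector G s) :
    ArrowsMatch G t := by
  classical
  intro c
  by_contra! hno
  have hsup : ∀ j, t j ≤ univ.sup t := fun j => le_sup (mem_univ j)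
  have hbar : ∀ j, ∃ (A : Finset V) (L : V → V),
      (∀ u v, G.Adj u v → c s(u, v) = j → u ∉ A → v ∉ A → L u = L v) ∧
      #A + ∑ k, #{x ∈ Aᶜ | L x = k} / 2 < t j := by
    intro j
    let Gj : SimpleGraph V :=
      { Adj := fun u v => G.Adj u v ∧ c s(u, v) = j
        symm := ⟨fun u v h => ⟨h.1.symm, Sym2.eq_swap ▸ h.2⟩⟩
        loopless := ⟨fun u h => h.1.ne rfl⟩ }
    have h2 : 2 * t j ≤ Fintype.card V := by
      have h1 : t j - 1 ≤ ∑ j, (t j - 1) :=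
        single_le_sum (f := fun j => t j - 1) (fun _ _ => Nat.zero_le _) (mem_univ j)
      have := hsup j
      have := ht j
      omega
    have hedge : ∀ e, e ∈ Gj.edgeSet → e ∈ G.edgeSet ∧ c e = j := by
      intro e
      induction e with | _ u v => exact id
    obtain ⟨A, L, hL, hA⟩ := exists_tutteBerge_barrier Gj (t j) h2 fun M hM hcard => by
      obtain ⟨e, he, hne⟩ := hno j M ⟨fun e he => (hedge e (hM.1 e he)).1, hM.2⟩ hcard
      exact hne (hedge e (hM.1 e he)).2
    exact ⟨A, L, fun u v h hc => hL u v ⟨h, hc⟩, hA⟩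
  choose A L hL hA using hbar
  let B : Finset V := univ.biUnion A
  have hmemB : ∀ (v : {v // v ∉ B}) j, v.1 ∉ A j := fun v j h =>
    v.2 (mem_biUnion.2 ⟨j, mem_univ j, h⟩)
  have hF : ∀ j, ∑ k, #{x : {v // v ∉ B} | L j x = k} / 2 ≤ ∑ k, #{x ∈ (A j)ᶜ | L j x = k} / 2 := by
    intro j
    refine sum_le_sum fun k _ => Nat.div_le_div_right ?_
    refine card_le_card_of_injOn Subtype.val (fun x hx => ?_) Subtype.val_injective.injOn
    simpa [hmemB x j] using hx
  have hcore := card_le_sum_half_parts (α := {v // v ∉ B}) hq (s - 1) (fun j x => L j x)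
    (fun X Y hXY hX hY => by
      obtain ⟨_, ⟨x, hx, rfl⟩, _, ⟨y, hy, rfl⟩, hadj⟩ := hG
        (Set.image Subtype.val (X : Set {v // v ∉ B})) (Set.image Subtype.val (Y : Set {v // v ∉ B}))
        ((Set.disjoint_image_iff Subtype.val_injective).2 (disjoint_coe.2 hXY))
        (by rw [Set.ncard_image_of_injective _ Subtype.val_injective, Set.ncard_coe_finset]; omega)
        (by rw [Set.ncard_image_of_injective _ Subtype.val_injective, Set.ncard_coe_finset]; omega)
      exact ⟨x, hx, y, hy, c s(x.1, y.1), hL _ _ _ hadj rfl (hmemB x _) (hmemB y _)⟩)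
    (univ.sup t - 1) (fun j => by
      have := hF j
      have := hA j
      have := hsup j
      omega)
  have hB : #B ≤ ∑ j, #(A j) := card_biUnion_le
  have hV : Fintype.card {v // v ∉ B} = Fintype.card V - #B := by simp
  have hsum : ∑ j, #(A j) + ∑ j, ∑ k, #{x : {v // v ∉ B} | L j x = k} / 2 ≤ ∑ j, (t j - 1) := by
    rw [← sum_add_distrib]
    refine sum_le_sum fun j _ => ?_
    have := hF j
    have := hA j
    omega
  have h1 := hsup ⟨0, hq⟩
  have h2 := ht ⟨0, hq⟩
  omega
end

section
/- For all integers q, s ≥ 1 and every t = (t_1,…,t_q) ∈ ℕ_+^q, there exists an n-vertex s-connector G with n = ‖t‖_∞ + Λ_t + s − 1 such that G ↛ tK_2 (i.e., there is a colouring c : E(G) → {1,…,q} such that for every j ∈ {1,…,q} there is no matching of size t_j in colour j). -/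
open SimpleGraph

variable {V : Type*}

/-- Every prescription of fibre sizes summing to `n` is realised by a map out of `Fin n`. -/
lemma exists_map_card_fiber {α : Type*} [Fintype α] [DecidableEq α] (w : α → ℕ) {n : ℕ}
    (hn : ∑ a, w a = n) :
    ∃ f : Fin n → α, ∀ a, (Finset.univ.filter fun v => f v = a).card = w a := by
  have hcard : Fintype.card (Σ a, Fin (w a)) = n := by simp [hn]
  let e := (Fintype.equivFinOfCardEq hcard).symm
  refine ⟨fun v => (e v).1, fun a => ?_⟩
  rw [← Fintype.card_subtype,
    Fintype.card_congr ((e.subtypeEquiv fun _ => Iff.rfl).trans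
      (Equiv.sigmaSubtype (β := fun a => Fin (w a)) a)),
    Fintype.card_fin]

/-- If every edge of a matching has at least `k` endpoints in `S`, then the matching has at
most `|S| / k` edges. -/
lemma IsMatchingSet.mul_card_le [DecidableEq V] {G : SimpleGraph V} {M : Finset (Sym2 V)}
    (hM : IsMatchingSet G M) {S : Finset V} {k : ℕ}
    (hk : ∀ e ∈ M, k ≤ (S.filter fun v => v ∈ e).card) : k * M.card ≤ S.card := by
  calc k * M.card = ∑ _e ∈ M, k := by rw [Finset.sum_const, smul_eq_mul, mul_comm]
    _ ≤ ∑ e ∈ M, (S.filter fun v => v ∈ e).card := Finset.sum_le_sum hk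
    _ = (M.biUnion fun e => S.filter fun v => v ∈ e).card := by
      refine (Finset.card_biUnion fun e he f hf hef => ?_).symm
      refine Finset.disjoint_left.2 fun v hv hv' => ?_
      exact hM.2 e he f hf hef v (Finset.mem_filter.1 hv).2 (Finset.mem_filter.1 hv').2
    _ ≤ S.card := Finset.card_le_card
      (Finset.biUnion_subset.2 fun _ _ => Finset.filter_subset _ _)

/-- The complete graph on the complement of `I`, with the vertices of `I` isolated. -/
def cliqueOff (I : Set V) : SimpleGraph V where
  Adj a b := a ≠ b ∧ a ∉ I ∧ b ∉ I
  symm := ⟨fun _ _ ⟨h, ha, hb⟩ => ⟨h.symm, hb, ha⟩⟩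
  loopless := ⟨fun _ h => h.1 rfl⟩

lemma isConnector_cliqueOff {I : Set V} {s : ℕ} (hfin : I.Finite) (hI : I.ncard < s) :
    IsConnector (cliqueOff I) s := by
  intro X Y hXY hX hY
  obtain ⟨x, hx, hxI⟩ := Set.exists_mem_notMem_of_ncard_lt_ncard (hI.trans_le hX) hfin
  obtain ⟨y, hy, hyI⟩ := Set.exists_mem_notMem_of_ncard_lt_ncard (hI.trans_le hY) hfin
  exact ⟨x, hx, y, hy, hXY.ne_of_mem hx hy, hxI, hyI⟩

/-- Let the vertices outside `I` be labelled by colours. If the label `m` is used fewer than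
`2 * t m` times, and each other label `j` fewer than `t j` times, then the edges of
`cliqueOff I` can be coloured without a matching of size `t j` in any colour `j`. -/
lemma not_arrowsMatch_cliqueOff [Fintype V] {q : ℕ} {t : Fin q → ℕ} (m : Fin q)
    (f : V → Option (Fin q))
    (hm : (Finset.univ.filter fun v => f v = some m).card < 2 * t m)
    (hf : ∀ j ≠ m, (Finset.univ.filter fun v => f v = some j).card < t j) :
    ¬ ArrowsMatch (cliqueOff {v | f v = none}) t := by
  classical
  let c : Sym2 V → Fin q := fun e =>
    if h : ∃ j, j ≠ m ∧ ∃ v ∈ e, f v = some j then h.choose else m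
  intro h
  obtain ⟨j, M, hM, hcard, hc⟩ := h c
  by_cases hj : j = m
  · subst hj
    refine (hm.trans_le ?_).false
    rw [← hcard]
    refine hM.mul_card_le fun e he => ?_
    have hno : ¬ ∃ i, i ≠ j ∧ ∃ v ∈ e, f v = some i := by
      intro hex
      have hce := hc e he
      simp only [c, dif_pos hex] at hce
      exact hex.choose_spec.1 hce
    have hadj := hM.1 e he
    induction e with
    | _ x y =>
      obtain ⟨hxy, hx, hy⟩ := hadj
      have hlabel : ∀ v ∈ s(x, y), f v ≠ none → f v = some j := by
        intro v hv hne
        obtain ⟨i, hi⟩ := Option.ne_none_iff_exists'.1 hne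
        by_contra hij
        exact hno ⟨i, fun h => hij (h ▸ hi), v, hv, hi⟩
      rw [← Finset.card_pair hxy]
      refine Finset.card_le_card fun v hv => ?_
      rcases Finset.mem_insert.1 hv with rfl | hv
      · simp [hlabel v (by simp) hx]
      · obtain rfl := Finset.mem_singleton.1 hv
        simp [hlabel v (by simp) hy]
  · refine ((hf j hj).trans_le ?_).false
    rw [← hcard, ← one_mul M.card]
    refine hM.mul_card_le fun e he => ?_
    have hce := hc e he
    by_cases hex : ∃ i, i ≠ m ∧ ∃ v ∈ e, f v = some i
    · simp only [c, dif_pos hex] at hce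
      obtain ⟨v, hv, hfv⟩ := hex.choose_spec.2
      rw [hce] at hfv
      exact Finset.card_pos.2 ⟨v, by simp [hv, hfv]⟩
    · simp only [c, dif_neg hex] at hce
      exact absurd hce.symm hj

/-- **Proposition 2 (sharpness).** For all `q, s ≥ 1` and `t ∈ ℕ₊^q` there is an
`n`-vertex `s`-connector `G` with `n = ‖t‖_∞ + Λ_t + s - 1` and `G ↛ tK₂`. -/
theorem sharpness {q s : ℕ} (hq : 1 ≤ q) (hs : 1 ≤ s)
    (t : Fin q → ℕ) (ht : ∀ j, 1 ≤ t j) :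
    ∃ G : SimpleGraph (Fin (Finset.univ.sup t + (∑ j, (t j - 1)) + s - 1)),
      IsConnector G s ∧ ¬ ArrowsMatch G t := by
  have : Nonempty (Fin q) := ⟨⟨0, hq⟩⟩
  obtain ⟨m, -, hm⟩ := Finset.exists_mem_eq_sup Finset.univ Finset.univ_nonempty t
  let w : Option (Fin q) → ℕ := fun o =>
    o.elim (s - 1) fun j => t j - 1 + if j = m then t m else 0
  have hw : ∑ o, w o = Finset.univ.sup t + (∑ j, (t j - 1)) + s - 1 := by
    simp only [w, Fintype.sum_option, Option.elim, Finset.sum_add_distrib, Finset.sum_ite_eq',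
      Finset.mem_univ, if_true, hm]
    omega
  obtain ⟨f, hf⟩ := exists_map_card_fiber w hw
  refine ⟨cliqueOff {v | f v = none}, isConnector_cliqueOff (Set.toFinite _) ?_,
    not_arrowsMatch_cliqueOff m f ?_ fun j hj => ?_⟩
  · have hnone := hf none
    rw [← Set.ncard_coe_finset, Finset.coe_filter_univ] at hnone
    rw [hnone]
    exact Nat.sub_lt hs one_pos
  · have := ht m
    simp only [hf, w, Option.elim, if_true]
    omega
  · have := ht j
    simp only [hf, w, Option.elim, if_neg hj]
    omega
end

section
/- Let G = (V,E) be a finite graph with Gallai–Edmonds decomposition GE(G) = (C,A,D). Suppose C ≠ ∅ and D ≠ ∅, and obtain G' from G by adding a single edge with one endpoint in C and the other in D. Then ν(G') = ν(G). -/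
open SimpleGraph

variable {V : Type*}

/-- The sizes of the matchings of a finite graph are bounded. -/
theorem bddAbove_matching_card {V : Type*} [Finite V] (G : SimpleGraph V) :
    BddAbove {n | ∃ M : Finset (Sym2 V), IsMatchingSet G M ∧ M.card = n} := by
  classical
  have := Fintype.ofFinite V
  refine ⟨Fintype.card (Sym2 V), ?_⟩
  rintro n ⟨M, -, rfl⟩
  exact M.card_le_univ

theorem IsMatchingSet.card_le_matchingNumber {V : Type*} [Finite V] {G : SimpleGraph V}
    {M : Finset (Sym2 V)} (hM : IsMatchingSet G M) : M.card ≤ matchingNumber G :=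
  le_csSup (bddAbove_matching_card G) ⟨M, hM, rfl⟩

theorem matchingNumber_le {V : Type*} {G : SimpleGraph V} {n : ℕ}
    (h : ∀ M : Finset (Sym2 V), IsMatchingSet G M → M.card ≤ n) : matchingNumber G ≤ n := by
  refine csSup_le ⟨0, ∅, by simp [IsMatchingSet], rfl⟩ ?_
  rintro _ ⟨M, hM, rfl⟩
  exact h M hM

theorem IsMatchingSet.mono {V : Type*} {G H : SimpleGraph V} (h : G ≤ H)
    {M : Finset (Sym2 V)} (hM : IsMatchingSet G M) : IsMatchingSet H M :=
  ⟨fun e he => SimpleGraph.edgeSet_mono h (hM.1 e he), hM.2⟩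

/-- Erasing the added edge from a matching of `G + uv` gives a matching of `G`. -/
theorem IsMatchingSet.erase_added_edge {V : Type*} [DecidableEq V] {G : SimpleGraph V} {u v : V}
    {M : Finset (Sym2 V)} (hM : IsMatchingSet (G ⊔ SimpleGraph.fromEdgeSet {s(u, v)}) M) :
    IsMatchingSet G (M.erase s(u, v)) := by
  refine ⟨fun e he => ?_, fun e he f hf =>
    hM.2 e (Finset.mem_of_mem_erase he) f (Finset.mem_of_mem_erase hf)⟩
  have h := hM.1 e (Finset.mem_of_mem_erase he)
  rw [SimpleGraph.edgeSet_sup, SimpleGraph.edgeSet_fromEdgeSet] at h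
  exact h.resolve_right fun h' => Finset.ne_of_mem_erase he h'.1

/-- **Lemma 2.3 (`CD`-edges).** If `GE(G) = (C, A, D)`, `u ∈ C` and `v ∈ D`
(in particular `C` and `D` are nonempty), then adding the edge `{u, v}` to `G`
does not change the matching number. -/
theorem CD_edge_matchingNumber {V : Type*} [Fintype V] (G : SimpleGraph V) (u v : V)
    (hu : u ∈ geC G) (hv : v ∈ geD G) :
    matchingNumber (G ⊔ SimpleGraph.fromEdgeSet {s(u, v)}) = matchingNumber G := by
  classical
  refine le_antisymm (matchingNumber_le fun M hM => ?_)
    (matchingNumber_le fun M hM => (hM.mono le_sup_left).card_le_matchingNumber)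
  have hN := hM.erase_added_edge
  have hle := hN.card_le_matchingNumber
  by_cases hmem : s(u, v) ∈ M
  · have hcard := Finset.card_erase_add_one hmem
    have hne : (M.erase s(u, v)).card ≠ matchingNumber G := fun h =>
      hu.1 ⟨_, hN, h, fun e he =>
        hM.2 _ hmem e (Finset.mem_of_mem_erase he) (Finset.ne_of_mem_erase he).symm u
          (Sym2.mem_mk_left u v)⟩
    omega
  · rwa [Finset.erase_eq_of_notMem hmem] at hle
end

section
/- Let 𝒢 = (G_0,G_1,…,G_q) be a proper acyclic q-multicolouring of a finite graph G. Then for every two distinct edges K_1, K_2 of 𝒞(𝒢) (i.e., distinct monochromatic connected components) it holds that |K_1 ∩ K_2| ≤ 1 and ν_G(K_1,K_2) ≤ 1. -/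
open SimpleGraph

variable {V : Type*}

/-- If hyperedges `k` and `l` both meet a hyperedge `m`, in `a` and `b` respectively, then
some path of the incidence graph from `k` to `l` leaves `k` through `a` or `b`. -/
theorem exists_path_snd_eq_or {V ι : Type*} {E : ι → Set V} {k l m : ι} (hkl : k ≠ l) {a b : V}
    (hak : a ∈ E k) (ham : a ∈ E m) (hbm : b ∈ E m) (hbl : b ∈ E l) :
    ∃ p : (incGraph E).Walk (Sum.inr k) (Sum.inr l),
      p.IsPath ∧ (p.snd = Sum.inl a ∨ p.snd = Sum.inl b) := by
  have down {v : V} {i : ι} (h : v ∈ E i) : (incGraph E).Adj (Sum.inr i) (Sum.inl v) :=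
    Or.inr ⟨v, i, rfl, rfl, h⟩
  have up {v : V} {i : ι} (h : v ∈ E i) : (incGraph E).Adj (Sum.inl v) (Sum.inr i) :=
    (down h).symm
  have short {v : V} (hk : v ∈ E k) (hl : v ∈ E l) :
      ∃ p : (incGraph E).Walk (Sum.inr k) (Sum.inr l), p.IsPath ∧ p.snd = Sum.inl v :=
    ⟨.cons (down hk) (.cons (up hl) .nil), by simp [Walk.cons_isPath_iff, hkl], by simp⟩
  by_cases hab : a = b
  · obtain ⟨p, hp, h⟩ := short hak (hab ▸ hbl)
    exact ⟨p, hp, Or.inl h⟩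
  by_cases hmk : m = k
  · obtain ⟨p, hp, h⟩ := short (hmk ▸ hbm) hbl
    exact ⟨p, hp, Or.inr h⟩
  by_cases hml : m = l
  · obtain ⟨p, hp, h⟩ := short hak (hml ▸ ham)
    exact ⟨p, hp, Or.inl h⟩
  exact ⟨.cons (down hak) (.cons (up ham) (.cons (down hbm) (.cons (up hbl) .nil))),
    by simp [Walk.cons_isPath_iff, hkl, hab, hml, Ne.symm hmk], Or.inl (by simp)⟩

/-- In a hyperforest, two connections between the same pair of hyperedges share a vertex. -/
theorem IsHyperforest.not_disjoint_connections {V ι : Type*} {E : ι → Set V}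
    (hE : IsHyperforest E) {k l m n : ι} (hkl : k ≠ l) {a b c d : V}
    (hak : a ∈ E k) (ham : a ∈ E m) (hbm : b ∈ E m) (hbl : b ∈ E l)
    (hck : c ∈ E k) (hcn : c ∈ E n) (hdn : d ∈ E n) (hdl : d ∈ E l) :
    a = c ∨ a = d ∨ b = c ∨ b = d := by
  obtain ⟨p, hp, hps⟩ := exists_path_snd_eq_or hkl hak ham hbm hbl
  obtain ⟨r, hr, hrs⟩ := exists_path_snd_eq_or hkl hck hcn hdn hdl
  have hpr : p = r := congrArg Subtype.val ((hE.subsingleton_path _ _).elim ⟨p, hp⟩ ⟨r, hr⟩)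
  subst hpr
  rcases hps with hps | hps <;> rcases hrs with hrs | hrs <;>
    have := Sum.inl_injective (hps.symm.trans hrs) <;> tauto

/-- A vertex reachable from a different vertex has a neighbour. -/
theorem exists_adj_of_reachable_of_ne {V : Type*} {G : SimpleGraph V} {a b : V}
    (h : G.Reachable a b) (hab : a ≠ b) : ∃ c, G.Adj a c := by
  obtain ⟨w⟩ := h
  cases w with
  | nil => exact absurd rfl hab
  | cons hadj _ => exact ⟨_, hadj⟩

/-- A monochromatic component with at least two vertices avoids `S`. -/
theorem IsSProper.notMem_of_mem_compEdge {V : Type*} {q : ℕ} {G G0 : SimpleGraph V}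
    {Gc : Fin q → SimpleGraph V} {S : Set V} (hS : IsSProper G G0 Gc S)
    (hcol : IsMulticolouring G G0 Gc) (p : CompIdx Gc) {a b : V}
    (ha : a ∈ CompEdge Gc p) (hb : b ∈ CompEdge Gc p) (hab : a ≠ b) : a ∉ S := by
  obtain ⟨j, K, v, rfl⟩ := p
  obtain ⟨c, hc⟩ := exists_adj_of_reachable_of_ne
    (Reachable.trans (G := Gc j) ha (Reachable.symm hb)) hab
  intro haS
  have hG : G.Adj a c := ((le_iSup Gc j).trans (le_sup_right.trans_eq hcol)) hc
  have h0 : s(a, c) ∈ G0.edgeSet := by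
    rw [hS.1]
    exact ⟨hG, a, haS, Sym2.mem_mk_left a c⟩
  exact Set.disjoint_left.mp (hS.2 j) h0 hc

/-- The endpoints of an edge avoiding `S` lie in a common monochromatic component. -/
theorem IsSProper.exists_compEdge_of_adj {V : Type*} {q : ℕ} {G G0 : SimpleGraph V}
    {Gc : Fin q → SimpleGraph V} {S : Set V} (hS : IsSProper G G0 Gc S)
    (hcol : IsMulticolouring G G0 Gc) {a b : V} (hab : G.Adj a b) (ha : a ∉ S) (hb : b ∉ S) :
    ∃ p : CompIdx Gc, a ∈ CompEdge Gc p ∧ b ∈ CompEdge Gc p := by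
  have hsup : (G0 ⊔ ⨆ j, Gc j).Adj a b := by rwa [show G0 ⊔ (⨆ j, Gc j) = G from hcol]
  rw [sup_adj, iSup_adj] at hsup
  rcases hsup with h0 | ⟨j, hj⟩
  · have hmem : s(a, b) ∈ G0.edgeSet := h0
    rw [hS.1] at hmem
    obtain ⟨-, v, hv, hvab⟩ := hmem
    rcases Sym2.mem_iff.mp hvab with rfl | rfl
    · exact absurd hv ha
    · exact absurd hv hb
  · exact ⟨⟨j, compSet (Gc j) a, a, rfl⟩, Reachable.refl a, hj.symm.reachable⟩

/-- **Lemma 3.3.** If `𝒢` is a proper acyclic `q`-multicolouring of `G`, then any two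
distinct hyperedges `K₁, K₂` of `𝒞(𝒢)` (distinct monochromatic connected components)
satisfy `|K₁ ∩ K₂| ≤ 1` and `ν_G(K₁, K₂) ≤ 1`. -/
theorem bridge_lemma {V : Type*} [Fintype V] {q : ℕ} (G G0 : SimpleGraph V)
    (Gc : Fin q → SimpleGraph V) (hcol : IsMulticolouring G G0 Gc)
    (hproper : ∃ S : Set V, IsSProper G G0 Gc S)
    (hacyc : ColouringAcyclic Gc)
    (p₁ p₂ : CompIdx Gc) (hne : p₁ ≠ p₂) :
    (CompEdge Gc p₁ ∩ CompEdge Gc p₂).ncard ≤ 1 ∧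
      nuBetween G (CompEdge Gc p₁) (CompEdge Gc p₂) ≤ 1 := by
  obtain ⟨S, hS⟩ := hproper
  refine ⟨(Set.ncard_le_one (Set.toFinite _)).mpr fun a ha b hb => ?_, csSup_le' ?_⟩
  · rcases hacyc.not_disjoint_connections hne ha.1 ha.1 ha.1 ha.2 hb.1 hb.1 hb.1 hb.2 with
      h | h | h | h <;> exact h
  rintro _ ⟨M, ⟨hMG, hMd⟩, rfl, hM⟩
  refine Finset.card_le_one.mpr fun e he f hf => ?_
  by_contra hef
  have hdisj := hMd e he f hf hef
  obtain ⟨a, ha, b, hb, rfl⟩ := hM e he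
  obtain ⟨c, hc, d, hd, rfl⟩ := hM f hf
  have hac : a ≠ c := by rintro rfl; exact hdisj a (by simp) (by simp)
  have had : a ≠ d := by rintro rfl; exact hdisj a (by simp) (by simp)
  have hbc : b ≠ c := by rintro rfl; exact hdisj b (by simp) (by simp)
  have hbd : b ≠ d := by rintro rfl; exact hdisj b (by simp) (by simp)
  obtain ⟨m, ham, hbm⟩ := hS.exists_compEdge_of_adj hcol (hMG _ he)
    (hS.notMem_of_mem_compEdge hcol p₁ ha hc hac) (hS.notMem_of_mem_compEdge hcol p₂ hb hd hbd)
  obtain ⟨n, hcn, hdn⟩ := hS.exists_compEdge_of_adj hcol (hMG _ hf)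
    (hS.notMem_of_mem_compEdge hcol p₁ hc ha hac.symm)
    (hS.notMem_of_mem_compEdge hcol p₂ hd hb hbd.symm)
  have := hacyc.not_disjoint_connections hne ha ham hbm hb hc hcn hdn hd
  tauto
end

section
/- Let s_1,…,s_ℓ be positive real numbers with n = Σ_{i=1}^ℓ s_i, and suppose s_i ≤ 2n/3 for all i. Then there exists a subset I ⊆ {1,…,ℓ} such that n/3 ≤ Σ_{i∈I} s_i ≤ 2n/3. -/
open SimpleGraph

variable {V : Type*}

/-- **Lemma 3.7.** If `s₁, …, s_ℓ` are positive reals with sum `n` and `s_i ≤ 2n/3` for all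
`i`, then some subset `I ⊆ [ℓ]` satisfies `n/3 ≤ ∑_{i ∈ I} s_i ≤ 2n/3`. -/
theorem subset_sum_middle_third {ℓ : ℕ} (s : Fin ℓ → ℝ) (hs : ∀ i, 0 < s i)
    (n : ℝ) (hn : n = ∑ i, s i) (hbd : ∀ i, s i ≤ 2 * n / 3) :
    ∃ I : Finset (Fin ℓ), n / 3 ≤ ∑ i ∈ I, s i ∧ ∑ i ∈ I, s i ≤ 2 * n / 3 := by
  by_contra! h
  have hn0 : 0 ≤ n := hn ▸ Finset.sum_nonneg fun i _ => (hs i).le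
  have small : ∀ i, s i < n / 3 := fun i => by
    by_contra! hi
    have := h {i} (by simpa using hi)
    rw [Finset.sum_singleton] at this
    exact absurd (hbd i) this.not_ge
  have sum_small : ∀ J : Finset (Fin ℓ), ∑ i ∈ J, s i < n / 3 := fun J => by
    induction J using Finset.induction_on with
    | empty =>
      by_contra! hJ
      have := h ∅ hJ
      rw [Finset.sum_empty] at this
      linarith
    | insert a J ha ih =>
      by_contra! hJ
      have := h _ hJ
      rw [Finset.sum_insert ha] at this
      linarith [small a]
  linarith [sum_small Finset.univ]
end
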